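/- Let q be a positive integer and λ a partition. Then c^{(q)}_λ = |𝒲^{(q)}_{r(λ)}| · (∏_{i=0}^{q−1} r_i(λ)!)/(∏_{s ≥ 1} n_s(λ)!) · C(ℓ(λ)−1, r₀(λ)), where C(·,·) denotes the binomial coefficient (with C(m,k) = 0 when k > m). -/

import Mathlib

open Finset

/-- A composition: a list of positive natural numbers. -/
def IsComposition (δ : List ℕ) : Prop := ∀ x ∈ δ, 0 < x

/-- `δ` is `q'`-cumulative: no partial sum of `δ` (including the total sum, so
that the empty composition is excluded) is divisible by `q`. -/
def QCum (q : ℕ) (δ : List ℕ) : Prop :=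
  ¬ q ∣ δ.sum ∧ ∀ j, 1 ≤ j → j ≤ δ.length → ¬ q ∣ (δ.take j).sum

/-- The partition `((q-1)^{r (q-1)}, …, 2^{r 2}, 1^{r 1})` as a multiset. -/
def muOf (q : ℕ) (r : ℕ → ℕ) : Multiset ℕ :=
  ∑ i ∈ Finset.Ico 1 q, Multiset.replicate (r i) i

/-- `𝒲^{(q)}_r`: the set of `q'`-cumulative compositions which rearrange to the
partition `((q-1)^{r (q-1)}, …, 2^{r 2}, 1^{r 1})`. -/
def W (q : ℕ) (r : ℕ → ℕ) : Set (List ℕ) :=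
  {δ | (↑δ : Multiset ℕ) = muOf q r ∧ QCum q δ}

/-- `r_j(λ)`: the number of parts `i ≥ 1` of `λ` with `i ≡ j (mod q)`. -/
def rres (q : ℕ) (lam : Multiset ℕ) (j : ℕ) : ℕ :=
  Multiset.card (lam.filter fun i => 1 ≤ i ∧ i % q = j)

/-- `c^{(q)}_λ`: the number of `q'`-cumulative compositions rearranging to `λ`. -/
noncomputable def cnum (q : ℕ) (lam : Multiset ℕ) : ℕ :=
  Nat.card {δ : List ℕ // (↑δ : Multiset ℕ) = lam ∧ QCum q δ}

/-- `‖r‖ = ∑_{i=1}^{q-1} i·r_i`. -/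
def normk (q : ℕ) (r : ℕ → ℕ) : ℕ := ∑ i ∈ Finset.Ico 1 q, i * r i

/-- `|r|_q = (q-1) + ∑_{i=2}^{q-1} (q-i)·r_i`. -/
def absq (q : ℕ) (r : ℕ → ℕ) : ℕ := (q - 1) + ∑ i ∈ Finset.Ico 2 q, (q - i) * r i

/-- `max r = max{r_1, …, r_{q-1}}`. -/
def maxr (q : ℕ) (r : ℕ → ℕ) : ℕ := (Finset.Ico 1 q).sup r

/-- Prefix condition with initial sum `a`. -/
def QQ (q : ℕ) : ℕ → List ℕ → Prop
  | _, [] => True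
  | a, x :: l => ¬ q ∣ a + x ∧ QQ q (a + x) l

/-- Labelled count. -/
def GG (q : ℕ) : ℕ → ℕ → Multiset ℕ → ℕ
  | 0, _, _ => 1
  | n + 1, a, s => (s.map fun x => if q ∣ a + x then 0 else GG q n (a + x) (s.erase x)).sum

/-- Arrangements of a multiset. -/
def LL (s : Multiset ℕ) : Finset (List ℕ) := (Multiset.lists s).toFinset

lemma mem_LL (s : Multiset ℕ) (l : List ℕ) : l ∈ LL s ↔ s = (l : Multiset ℕ) := by
  rw [LL, Multiset.mem_toFinset, Multiset.mem_lists_iff]; rfl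

open Classical in
/-- Number of arrangements. -/
noncomputable def FF (q a : ℕ) (s : Multiset ℕ) : ℕ := ((LL s).filter (QQ q a)).card

/-- Product of factorials of multiplicities. -/
def PP (s : Multiset ℕ) : ℕ := ∏ x ∈ s.toFinset, (s.count x).factorial

lemma PP_superset (s : Multiset ℕ) (T : Finset ℕ) (h : s.toFinset ⊆ T) :
    PP s = ∏ x ∈ T, (s.count x).factorial := by
  unfold PP
  apply Finset.prod_subset h
  intro x _ hx
  rw [Multiset.mem_toFinset] at hx
  rw [Multiset.count_eq_zero_of_notMem hx]; rfl

lemma PP_erase (s : Multiset ℕ) (x : ℕ) (hx : x ∈ s) :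
    PP s = s.count x * PP (s.erase x) := by
  rw [PP_superset (s.erase x) s.toFinset
    (Multiset.toFinset_subset.2 (Multiset.erase_subset x s)), PP]
  have hx' : x ∈ s.toFinset := Multiset.mem_toFinset.2 hx
  rw [← Finset.mul_prod_erase _ _ hx', ← Finset.mul_prod_erase _ _ hx', ← mul_assoc,
    Multiset.count_erase_self]
  congr 1
  · exact (Nat.mul_factorial_pred (Multiset.count_pos.2 hx).ne').symm
  · apply Finset.prod_congr rfl
    intro y hy
    rw [Multiset.count_erase_of_ne (Finset.ne_of_mem_erase hy)]

lemma PP_pos (s : Multiset ℕ) : 0 < PP s := Finset.prod_pos fun _ _ => Nat.factorial_pos _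

open Classical in
lemma FF_rec (q a : ℕ) (s : Multiset ℕ) (hs : s ≠ 0) :
    FF q a s = ∑ x ∈ s.toFinset, if q ∣ a + x then 0 else FF q (a + x) (s.erase x) := by
  have key : (LL s).filter (QQ q a) =
      s.toFinset.biUnion fun x => if q ∣ a + x then ∅ else
        ((LL (s.erase x)).filter (QQ q (a + x))).map
          ⟨List.cons x, List.cons_injective⟩ := by
    ext l
    simp only [Finset.mem_filter, mem_LL, Finset.mem_biUnion,
      Multiset.mem_toFinset]
    constructor
    · rintro ⟨h1, h2⟩
      cases l with
      | nil => exact absurd h1 hs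
      | cons x l =>
        refine ⟨x, by simp [h1], ?_⟩
        rw [if_neg h2.1]
        simp only [Finset.mem_map, Finset.mem_filter, mem_LL]
        refine ⟨l, ⟨?_, h2.2⟩, rfl⟩
        rw [h1]; simp
    · rintro ⟨x, hx, h⟩
      split_ifs at h with hd
      · simp at h
      · simp only [Finset.mem_map, Finset.mem_filter, mem_LL] at h
        obtain ⟨l', ⟨h1, h2⟩, rfl⟩ := h
        refine ⟨?_, hd, h2⟩
        have h3 : ((x :: l' : List ℕ) : Multiset ℕ) = s := by
          rw [← Multiset.cons_coe]
          have : (l' : Multiset ℕ) = s.erase x := h1.symm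
          rw [this, Multiset.cons_erase hx]
        exact h3.symm
  unfold FF
  rw [key, Finset.card_biUnion]
  · apply Finset.sum_congr rfl
    intro x _
    split_ifs <;> simp
  · intro x _ y _ hxy
    rw [Function.onFun, Finset.disjoint_left]
    intro l h1 h2
    split_ifs at h1 h2
    all_goals simp at h1 h2
    obtain ⟨l1, _, rfl⟩ := h1
    obtain ⟨l2, _, h⟩ := h2
    simp at h
    exact hxy h.1.symm

lemma FF_mul_PP (q : ℕ) : ∀ (n a : ℕ) (s : Multiset ℕ), s.card = n →
    FF q a s * PP s = GG q n a s := by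
  intro n
  induction n with
  | zero =>
    intro a s h
    rw [Multiset.card_eq_zero] at h
    subst h
    have : LL (0 : Multiset ℕ) = {[]} := by
      ext l; simp [mem_LL, eq_comm]
    simp [FF, PP, GG, this, Finset.filter_singleton, QQ]
  | succ n ih =>
    intro a s h
    have hs : s ≠ 0 := by rintro rfl; simp at h
    rw [FF_rec q a s hs, GG, Finset.sum_multiset_map_count, Finset.sum_mul]
    apply Finset.sum_congr rfl
    intro x hx
    rw [Multiset.mem_toFinset] at hx
    split_ifs
    · simp
    · rw [← ih (a + x) (s.erase x) (by rw [Multiset.card_erase_of_mem hx, h]; rfl),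
        PP_erase s x hx, smul_eq_mul]
      ring

lemma GG_congr (q : ℕ) : ∀ (n a b : ℕ) (s : Multiset ℕ), a % q = b % q →
    GG q n a s = GG q n b (s.map (· % q)) := by
  intro n
  induction n with
  | zero => intros; rfl
  | succ n ih =>
    intro a b s h
    rw [GG, GG, Multiset.map_map]
    congr 1
    apply Multiset.map_congr rfl
    intro x hx
    have h2 : (a + x) % q = (b + x % q) % q := by
      rw [Nat.add_mod, h]; simp [Nat.add_mod]
    simp only [Function.comp]
    have h3 : q ∣ a + x ↔ q ∣ b + x % q := by
      rw [Nat.dvd_iff_mod_eq_zero, Nat.dvd_iff_mod_eq_zero, h2]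
    simp only [h3]
    rw [ih _ _ (s.erase x) h2, Multiset.map_erase_of_mem _ _ hx]

lemma GG_congr' (q n a b : ℕ) (s : Multiset ℕ) (h : a % q = b % q) :
    GG q n a s = GG q n b s := by
  rw [GG_congr q n a b s h, GG_congr q n b b s rfl]

/-- Parts divisible by q. -/
def ZZ (q : ℕ) (s : Multiset ℕ) : Multiset ℕ := s.filter fun x => q ∣ x
/-- Parts not divisible by q. -/
def NN (q : ℕ) (s : Multiset ℕ) : Multiset ℕ := s.filter fun x => ¬ q ∣ x

lemma ZZ_NN (q : ℕ) (s : Multiset ℕ) : ZZ q s + NN q s = s := Multiset.filter_add_not _ s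

lemma card_ZZ_NN (q : ℕ) (s : Multiset ℕ) : (ZZ q s).card + (NN q s).card = s.card := by
  rw [← Multiset.card_add, ZZ_NN]

lemma GG_split (q n a : ℕ) (s : Multiset ℕ) : GG q (n + 1) a s =
    ((ZZ q s).map fun x => if q ∣ a + x then 0 else GG q n (a + x) (s.erase x)).sum +
    ((NN q s).map fun x => if q ∣ a + x then 0 else GG q n (a + x) (s.erase x)).sum := by
  rw [← Multiset.sum_add, ← Multiset.map_add, ZZ_NN, GG]

lemma erase_Z (q x : ℕ) (s : Multiset ℕ) (hx : x ∈ ZZ q s) :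
    NN q (s.erase x) = NN q s ∧ (ZZ q (s.erase x)).card + 1 = (ZZ q s).card := by
  obtain ⟨h1, h2⟩ := Multiset.mem_filter.1 hx
  obtain ⟨t, rfl⟩ := Multiset.exists_cons_of_mem h1
  simp [ZZ, NN, h2]

lemma erase_N (q x : ℕ) (s : Multiset ℕ) (hx : x ∈ NN q s) :
    NN q (s.erase x) = (NN q s).erase x ∧ ZZ q (s.erase x) = ZZ q s := by
  obtain ⟨h1, h2⟩ := Multiset.mem_filter.1 hx
  obtain ⟨t, rfl⟩ := Multiset.exists_cons_of_mem h1
  simp [ZZ, NN, h2]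

/-- Second half of the sum, given the formula one level lower. -/
lemma GG_N_part (q n a : ℕ) (s : Multiset ℕ) (hs : s.card = n + 1)
    (ih : ∀ (a : ℕ) (s : Multiset ℕ), s.card = n → ¬ q ∣ a →
      GG q n a s = GG q (NN q s).card a (NN q s) *
        (n.choose (ZZ q s).card * (ZZ q s).card.factorial)) :
    ((NN q s).map fun x => if q ∣ a + x then 0 else GG q n (a + x) (s.erase x)).sum =
      GG q (NN q s).card a (NN q s) * (n.choose (ZZ q s).card * (ZZ q s).card.factorial) := by
  have hc := card_ZZ_NN q s
  rcases Nat.eq_zero_or_pos (NN q s).card with h0 | h0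
  · rw [Nat.choose_eq_zero_of_lt (by omega)]
    rw [Multiset.card_eq_zero] at h0
    simp [h0]
  · obtain ⟨m, hm⟩ : ∃ m, (NN q s).card = m + 1 := ⟨_, (Nat.sub_add_cancel h0).symm⟩
    rw [hm, GG, ← Multiset.sum_map_mul_right]
    congr 1
    apply Multiset.map_congr rfl
    intro x hx
    have hxs : x ∈ s := Multiset.mem_of_mem_filter hx
    obtain ⟨e1, e2⟩ := erase_N q x s hx
    split_ifs with hd
    · simp
    · rw [ih _ _ (by rw [Multiset.card_erase_of_mem hxs, hs]; rfl) hd, e1, e2,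
        Multiset.card_erase_of_mem hx, hm]
      rfl

lemma GG_formula (q : ℕ) : ∀ (n a : ℕ) (s : Multiset ℕ), s.card = n → ¬ q ∣ a →
      GG q n a s = GG q (NN q s).card a (NN q s) *
        (n.choose (ZZ q s).card * (ZZ q s).card.factorial) := by
  intro n
  induction n with
  | zero =>
    intro a s h _
    rw [Multiset.card_eq_zero] at h
    subst h
    simp [GG, NN, ZZ]
  | succ n ih =>
    intro a s hs ha
    rw [GG_split, GG_N_part q n a s hs ih]
    have hZ : ((ZZ q s).map fun x => if q ∣ a + x then 0 else GG q n (a + x) (s.erase x)) =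
        (ZZ q s).map fun _ => GG q (NN q s).card a (NN q s) *
          (n.choose ((ZZ q s).card - 1) * ((ZZ q s).card - 1).factorial) := by
      apply Multiset.map_congr rfl
      intro x hx
      obtain ⟨hxs, hqx⟩ := Multiset.mem_filter.1 hx
      obtain ⟨e1, e2⟩ := erase_Z q x s hx
      have hd : ¬ q ∣ a + x := by rwa [Nat.dvd_add_left hqx]
      have hm : (a + x) % q = a % q := by
        obtain ⟨k, rfl⟩ := hqx
        simp
      rw [if_neg hd, GG_congr' q n (a + x) a _ hm,
        ih _ _ (by rw [Multiset.card_erase_of_mem hxs, hs]; rfl) ha, e1, ← e2,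
        Nat.add_sub_cancel]
    rw [hZ, Multiset.map_const', Multiset.sum_replicate, smul_eq_mul]
    cases h : (ZZ q s).card with
    | zero => simp
    | succ k =>
      rw [Nat.add_sub_cancel, Nat.choose_succ_succ, Nat.factorial_succ]
      ring

lemma GG_formula0 (q n : ℕ) (s : Multiset ℕ) (hs : s.card = n + 1) :
      GG q (n + 1) 0 s = GG q (NN q s).card 0 (NN q s) *
        (n.choose (ZZ q s).card * (ZZ q s).card.factorial) := by
  rw [GG_split, GG_N_part q n 0 s hs (GG_formula q n)]
  have hZ : ((ZZ q s).map fun x => if q ∣ 0 + x then 0 else GG q n (0 + x) (s.erase x)) =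
        (ZZ q s).map fun _ => 0 := by
    apply Multiset.map_congr rfl
    intro x hx
    rw [zero_add, if_pos (Multiset.mem_filter.1 hx).2]
  rw [hZ]
  simp

lemma QQ_iff (q : ℕ) : ∀ (l : List ℕ) (a : ℕ), QQ q a l ↔
    ∀ j, 1 ≤ j → j ≤ l.length → ¬ q ∣ a + (l.take j).sum := by
  intro l
  induction l with
  | nil => intro a; simp [QQ]; intro j h1 h2; omega
  | cons x l ih =>
    intro a
    rw [QQ, ih]
    constructor
    · rintro ⟨h1, h2⟩ j hj1 hj2
      obtain ⟨j, rfl⟩ : ∃ k, j = k + 1 := ⟨j - 1, by omega⟩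
      rw [List.take_succ_cons, List.sum_cons, ← add_assoc]
      rcases Nat.eq_zero_or_pos j with rfl | hj
      · simpa using h1
      · exact h2 j hj (by simpa using hj2)
    · intro h
      refine ⟨by simpa using h 1 le_rfl (by simp), ?_⟩
      intro j hj1 hj2
      have := h (j + 1) (by omega) (by simpa using hj2)
      rwa [List.take_succ_cons, List.sum_cons, ← add_assoc] at this

lemma QCum_iff (q : ℕ) (l : List ℕ) (h : l ≠ []) : QCum q l ↔ QQ q 0 l := by
  rw [QQ_iff, QCum]
  simp only [zero_add]
  refine ⟨fun h => h.2, fun h' => ⟨?_, h'⟩⟩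
  have := h' l.length (List.length_pos_iff.2 h) le_rfl
  rwa [List.take_length] at this

lemma card_eq_FF (q : ℕ) (s : Multiset ℕ) (hs : s ≠ 0) :
    Nat.card {δ : List ℕ // (↑δ : Multiset ℕ) = s ∧ QCum q δ} = FF q 0 s := by
  classical
  unfold FF
  rw [← Nat.card_eq_finsetCard]
  apply Nat.card_congr
  apply Equiv.subtypeEquivRight
  intro l
  rw [Finset.mem_filter, mem_LL]
  constructor
  · rintro ⟨h1, h2⟩
    refine ⟨h1.symm, (QCum_iff q l ?_).1 h2⟩
    rintro rfl
    exact hs h1.symm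
  · rintro ⟨h1, h2⟩
    refine ⟨h1.symm, (QCum_iff q l ?_).2 h2⟩
    rintro rfl
    exact hs h1

lemma rres_eq (q : ℕ) (s : Multiset ℕ) (hs : ∀ x ∈ s, 0 < x) (i : ℕ) :
    rres q s i = (s.filter fun x => x % q = i).card := by
  unfold rres
  congr 1
  apply Multiset.filter_congr
  intro x hx
  have := hs x hx
  simp; omega

lemma count_muOf (q : ℕ) (r : ℕ → ℕ) (i : ℕ) :
    (muOf q r).count i = if i ∈ Finset.Ico 1 q then r i else 0 := by
  unfold muOf
  rw [Multiset.count_sum']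
  simp only [Multiset.count_replicate]
  rw [Finset.sum_ite_eq']

lemma muOf_eq (q : ℕ) (hq : 0 < q) (s : Multiset ℕ) (hs : ∀ x ∈ s, 0 < x) :
    muOf q (rres q s) = (NN q s).map (· % q) := by
  ext i
  rw [count_muOf, Multiset.count_map, NN, Multiset.filter_filter]
  split_ifs with h
  · rw [Finset.mem_Ico] at h
    rw [rres_eq q s hs]
    congr 1
    apply Multiset.filter_congr
    intro x _
    rw [Nat.dvd_iff_mod_eq_zero]
    omega
  · symm
    rw [Multiset.card_eq_zero, Multiset.filter_eq_nil]
    rintro x _ ⟨h1, h2⟩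
    apply h
    rw [Nat.dvd_iff_mod_eq_zero] at h2
    rw [Finset.mem_Ico]
    have := Nat.mod_lt x hq
    omega

lemma PP_muOf (q : ℕ) (r : ℕ → ℕ) : PP (muOf q r) = ∏ i ∈ Finset.Ico 1 q, (r i).factorial := by
  rw [PP_superset _ (Finset.Ico 1 q)]
  · apply Finset.prod_congr rfl
    intro i hi
    rw [count_muOf, if_pos hi]
  · intro i hi
    rw [Multiset.mem_toFinset, ← Multiset.count_pos, count_muOf] at hi
    by_contra h
    simp [h] at hi

lemma PP_dvd (q : ℕ) (hq : 0 < q) (s : Multiset ℕ) (hs : ∀ x ∈ s, 0 < x) :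
    PP s ∣ ∏ i ∈ Finset.range q, (rres q s i).factorial := by
  unfold PP
  rw [← Finset.prod_fiberwise_of_maps_to (g := fun x => x % q) (t := Finset.range q)
    (fun x _ => Finset.mem_range.2 (Nat.mod_lt x hq))]
  apply Finset.prod_dvd_prod_of_dvd
  intro i _
  have : rres q s i = ∑ x ∈ s.toFinset with x % q = i, s.count x := by
    rw [rres_eq q s hs, ← Multiset.toFinset_sum_count_eq, Multiset.toFinset_filter]
    apply Finset.sum_congr rfl
    intro x hx
    rw [Multiset.count_filter, if_pos (Finset.mem_filter.1 hx).2]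
  rw [this]
  exact Nat.prod_factorial_dvd_factorial_sum _ _

/-- Proposition 1 (formula): `c^{(q)}_λ = |𝒲^{(q)}_{r(λ)}| ·
(∏_{i=0}^{q-1} r_i(λ)!)/(∏_{s≥1} n_s(λ)!) · C(ℓ(λ)-1, r₀(λ))`. -/
theorem stmt0 (q : ℕ) (hq : 0 < q) (lam : Multiset ℕ) (hlam : ∀ x ∈ lam, 0 < x) :
    cnum q lam =
      Nat.card ↥(W q (rres q lam)) *
        ((∏ i ∈ Finset.range q, Nat.factorial (rres q lam i)) /
          (∏ s ∈ lam.toFinset, Nat.factorial (lam.count s))) *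
        Nat.choose (Multiset.card lam - 1) (rres q lam 0) := by
  change _ = _ * (_ / PP lam) * _
  have hmu := muOf_eq q hq lam hlam
  have hr0 : rres q lam 0 = (ZZ q lam).card := by
    rw [rres_eq q lam hlam, ZZ]
    congr 1
    apply Multiset.filter_congr
    intro x _
    rw [Nat.dvd_iff_mod_eq_zero]
  have hcard := card_ZZ_NN q lam
  have hnil : ¬ QCum q [] := fun h => h.1 (by simp)
  by_cases h0 : lam = 0
  · have e1 : cnum q lam = 0 := by
      unfold cnum
      rw [Nat.card_eq_zero]
      left
      constructor
      rintro ⟨δ, h1, h2⟩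
      rw [h0, Multiset.coe_eq_zero] at h1
      exact hnil (h1 ▸ h2)
    have e2 : Nat.card ↥(W q (rres q lam)) = 0 := by
      rw [Nat.card_eq_zero]
      left
      constructor
      rintro ⟨δ, h1, h2⟩
      rw [hmu, h0] at h1
      have h3 : δ = [] := by simpa [NN] using h1
      exact hnil (h3 ▸ h2)
    rw [e1, e2]; simp
  obtain ⟨n, hn⟩ : ∃ n, lam.card = n + 1 :=
    ⟨_, (Nat.sub_add_cancel (Multiset.card_pos.2 h0)).symm⟩
  have hc : cnum q lam = FF q 0 lam := card_eq_FF q lam h0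
  have hF := FF_mul_PP q _ 0 lam hn
  rw [GG_formula0 q n lam hn] at hF
  rw [hc, hr0, hn, Nat.add_sub_cancel]
  apply Nat.eq_of_mul_eq_mul_right (PP_pos lam)
  rw [hF]
  by_cases hN : NN q lam = 0
  · have : (ZZ q lam).card = n + 1 := by rw [hN] at hcard; simpa [hn] using hcard
    rw [this, Nat.choose_eq_zero_of_lt (Nat.lt_succ_self n)]
    simp
  have hW : Nat.card ↥(W q (rres q lam)) = FF q 0 (muOf q (rres q lam)) := by
    apply card_eq_FF
    rw [hmu]
    simpa using hN
  have hG := FF_mul_PP q (NN q lam).card 0 (muOf q (rres q lam)) (by rw [hmu]; simp)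
  rw [PP_muOf, ← hW] at hG
  rw [GG_congr q _ 0 0 (NN q lam) rfl, ← hmu, ← hG]
  obtain ⟨k, hk⟩ := PP_dvd q hq lam hlam
  have hR : ∏ i ∈ Finset.range q, (rres q lam i).factorial =
      (ZZ q lam).card.factorial * ∏ i ∈ Finset.Ico 1 q, (rres q lam i).factorial := by
    rw [Finset.range_eq_Ico, Finset.prod_eq_prod_Ico_succ_bot hq, hr0]
  rw [hk, Nat.mul_div_cancel_left _ (PP_pos lam)]
  rw [hk] at hR
  calc _ = Nat.card ↥(W q (rres q lam)) * n.choose (ZZ q lam).card *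
      ((ZZ q lam).card.factorial * ∏ i ∈ Finset.Ico 1 q, (rres q lam i).factorial) := by ring
    _ = _ := by rw [← hR]; ring
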